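/- Let k be a field, Λ and Γ finite dimensional k-algebras, M a finitely generated (Λ,Γ)-bimodule that is projective both as a left Λ-module and as a right Γ-module, and N a finitely generated (Γ,Λ)-bimodule. Then the syzygy Ω_{Λ^e}(M ⊗_Γ N) is stably isomorphic, as a Λ^e-module, to M ⊗_Γ Ω_{Γ⊗_kΛ^op}(N). -/

import Mathlib

open TensorProduct MulOpposite

section BimodInfra

variable (k : Type) [Field k]

/-- The `k`-algebra endomorphism ring homomorphism sending a `k`-linear endomorphism `f` of `Y`
to `X ⊗ f`. -/
noncomputable def lTensorAlgHom (X Y : Type) [AddCommGroup X] [Module k X] [AddCommGroup Y] [Module k Y] :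
    Module.End k Y →ₐ[k] Module.End k (X ⊗[k] Y) where
  toFun f := LinearMap.lTensor X f
  map_one' := LinearMap.lTensor_id X Y
  map_mul' f g := LinearMap.lTensor_comp X f g
  map_zero' := LinearMap.lTensor_zero X
  map_add' f g := LinearMap.lTensor_add X f g
  commutes' c := by
    ext y
    simp [Module.algebraMap_end_apply, TensorProduct.smul_tmul', TensorProduct.tmul_smul]

/-- Same for `f ⊗ Y`. -/
noncomputable def rTensorAlgHom (X Y : Type) [AddCommGroup X] [Module k X] [AddCommGroup Y] [Module k Y] :
    Module.End k X →ₐ[k] Module.End k (X ⊗[k] Y) where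
  toFun f := LinearMap.rTensor Y f
  map_one' := LinearMap.rTensor_id Y X
  map_mul' f g := LinearMap.rTensor_comp Y f g
  map_zero' := LinearMap.rTensor_zero Y
  map_add' f g := LinearMap.rTensor_add Y f g
  commutes' c := by
    ext x
    simp [Module.algebraMap_end_apply, TensorProduct.smul_tmul', TensorProduct.tmul_smul]

variable (A B C : Type) [Ring A] [Ring B] [Ring C] [Algebra k A] [Algebra k B] [Algebra k C]
variable (X : Type) [AddCommGroup X] [Module k X] [Module (A ⊗[k] Bᵐᵒᵖ) X]
  [IsScalarTower k (A ⊗[k] Bᵐᵒᵖ) X]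
variable (Y : Type) [AddCommGroup Y] [Module k Y] [Module (B ⊗[k] Cᵐᵒᵖ) Y]
  [IsScalarTower k (B ⊗[k] Cᵐᵒᵖ) Y]

/-- The action of `A ⊗ Cᵐᵒᵖ` on `X ⊗[k] Y`: `A` acts through the left tensor factor of `X`,
`Cᵐᵒᵖ` acts through the right tensor factor of `Y`. -/
noncomputable def outerAction : (A ⊗[k] Cᵐᵒᵖ) →ₐ[k] Module.End k (X ⊗[k] Y) :=
  Algebra.TensorProduct.lift
    ((rTensorAlgHom k X Y).comp ((Algebra.lsmul k k X).comp
      (Algebra.TensorProduct.includeLeft : A →ₐ[k] A ⊗[k] Bᵐᵒᵖ)))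
    ((lTensorAlgHom k X Y).comp ((Algebra.lsmul k k Y).comp
      (Algebra.TensorProduct.includeRight : Cᵐᵒᵖ →ₐ[k] B ⊗[k] Cᵐᵒᵖ)))
    (fun a c => by
      show Commute (LinearMap.rTensor Y _) (LinearMap.lTensor X _)
      unfold Commute SemiconjBy
      ext x y
      simp [LinearMap.rTensor, LinearMap.lTensor, TensorProduct.map_tmul])

/-- The `(A ⊗ Cᵐᵒᵖ)`-module structure on `X ⊗[k] Y`. -/
noncomputable def outerModule : Module (A ⊗[k] Cᵐᵒᵖ) (X ⊗[k] Y) :=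
  Module.compHom _ (outerAction k A B C X Y).toRingHom

/-- The submodule of `X ⊗[k] Y` generated by the `B`-balancing relations
`(x·b) ⊗ y - x ⊗ (b·y)`. -/
noncomputable def balancedSub : @Submodule (A ⊗[k] Cᵐᵒᵖ) (X ⊗[k] Y) _ _
    (outerModule k A B C X Y) :=
  letI := outerModule k A B C X Y
  Submodule.span (A ⊗[k] Cᵐᵒᵖ)
    {z | ∃ (x : X) (b : B) (y : Y),
      z = ((((1 : A) ⊗ₜ[k] (op b)) • x) ⊗ₜ[k] y) - (x ⊗ₜ[k] ((b ⊗ₜ[k] (1 : Cᵐᵒᵖ)) • y))}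

/-- The balanced tensor product `X ⊗_B Y` of the `(A,B)`-bimodule `X` and the
`(B,C)`-bimodule `Y`, an `(A,C)`-bimodule, i.e. a left `A ⊗[k] Cᵐᵒᵖ`-module. -/
noncomputable def BTensor : Type :=
  letI := outerModule k A B C X Y
  (X ⊗[k] Y) ⧸ balancedSub k A B C X Y

noncomputable instance BTensor.instAddCommGroup : AddCommGroup (BTensor k A B C X Y) :=
  letI := outerModule k A B C X Y
  inferInstanceAs (AddCommGroup ((X ⊗[k] Y) ⧸ balancedSub k A B C X Y))

noncomputable instance BTensor.instModule : Module (A ⊗[k] Cᵐᵒᵖ) (BTensor k A B C X Y) :=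
  letI := outerModule k A B C X Y
  inferInstanceAs (Module (A ⊗[k] Cᵐᵒᵖ) ((X ⊗[k] Y) ⧸ balancedSub k A B C X Y))

noncomputable instance BTensor.instModuleK : Module k (BTensor k A B C X Y) :=
  Module.compHom _ (algebraMap k (A ⊗[k] Cᵐᵒᵖ))

noncomputable instance BTensor.instTower :
    IsScalarTower k (A ⊗[k] Cᵐᵒᵖ) (BTensor k A B C X Y) :=
  ⟨fun c s z => by
    have h : (c • s) = algebraMap k (A ⊗[k] Cᵐᵒᵖ) c * s := Algebra.smul_def c s
    rw [h, mul_smul]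
    rfl⟩

end BimodInfra

section Restrict

variable (k : Type) [Field k] (A B : Type) [Ring A] [Ring B] [Algebra k A] [Algebra k B]
variable (X : Type) [AddCommGroup X] [Module (A ⊗[k] Bᵐᵒᵖ) X]

/-- The left `A`-module structure on an `(A,B)`-bimodule. -/
noncomputable def leftRestrict : Module A X :=
  Module.compHom X (Algebra.TensorProduct.includeLeft : A →ₐ[k] A ⊗[k] Bᵐᵒᵖ).toRingHom

/-- The right `B`-module (left `Bᵐᵒᵖ`-module) structure on an `(A,B)`-bimodule. -/
noncomputable def rightRestrict : Module Bᵐᵒᵖ X :=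
  Module.compHom X (Algebra.TensorProduct.includeRight : Bᵐᵒᵖ →ₐ[k] A ⊗[k] Bᵐᵒᵖ).toRingHom

/-- The canonical `k`-module structure on a module over the `k`-algebra `S`. -/
def modK (S : Type) [Ring S] [Algebra k S] (Z : Type) [AddCommGroup Z] [Module S Z] :
    Module k Z :=
  Module.compHom Z (algebraMap k S)

/-- The compatibility of `modK` with the `S`-action. -/
def towerK (S : Type) [Ring S] [Algebra k S] (Z : Type) [AddCommGroup Z] [Module S Z] :
    letI := modK k S Z; IsScalarTower k S Z := by
  letI := modK k S Z
  exact ⟨fun c s z => by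
    have h : (c • s) = algebraMap k S c * s := Algebra.smul_def c s
    rw [h, mul_smul]
    rfl⟩

end Restrict

section Regular

variable (k : Type) [Field k] (A : Type) [Ring A] [Algebra k A]

/-- The regular `(A,A)`-bimodule structure on `A`: `(a ⊗ bᵒᵖ) • x = a * x * b`. -/
noncomputable def regularBimodule : Module (A ⊗[k] Aᵐᵒᵖ) A :=
  TensorProduct.Algebra.module

end Regular

/-- `p : P → M` is a projective cover: `P` is finitely generated projective, `p` is
surjective and `ker p` is superfluous in `P`. -/
def IsProjCover (S : Type) [Ring S] {P M : Type} [AddCommGroup P] [Module S P]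
    [AddCommGroup M] [Module S M] (p : P →ₗ[S] M) : Prop :=
  Module.Finite S P ∧ Module.Projective S P ∧ Function.Surjective p ∧
    ∀ L : Submodule S P, L ⊔ LinearMap.ker p = ⊤ → L = ⊤

/-- `Z` is a syzygy of `M`: the kernel of a projective cover of `M`. -/
def IsSyzygyOf (S : Type) [Ring S] (Z M : ModuleCat.{0} S) : Prop :=
  ∃ (P : ModuleCat.{0} S) (p : P →ₗ[S] M),
    IsProjCover S p ∧ Nonempty (Z ≃ₗ[S] LinearMap.ker p)

/-- `Z` is an `n`-th syzygy of `M` (with respect to projective covers). -/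
def IsNthSyzygyOf (S : Type) [Ring S] : ℕ → ModuleCat.{0} S → ModuleCat.{0} S → Prop
  | 0, Z, M => Nonempty (Z ≃ₗ[S] M)
  | n + 1, Z, M => ∃ W : ModuleCat.{0} S, IsNthSyzygyOf S n W M ∧ IsSyzygyOf S Z W

/-- `X` is periodic of period `p`: `Ω^p(X) ≅ X` and `p` is the least positive
integer with this property. -/
def IsPeriodicWithPeriod (S : Type) [Ring S] (X : ModuleCat.{0} S) (p : ℕ) : Prop :=
  0 < p ∧ (∃ Z, IsNthSyzygyOf S p Z X ∧ Nonempty (Z ≃ₗ[S] X)) ∧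
    ∀ q : ℕ, 0 < q → (∃ Z, IsNthSyzygyOf S q Z X ∧ Nonempty (Z ≃ₗ[S] X)) → p ≤ q

/-- `A` and `B` are stably isomorphic: `A ⊕ P ≅ B ⊕ Q` for some finitely generated
projective modules `P` and `Q`. -/
def StablyIso (S : Type) [Ring S] (A B : Type) [AddCommGroup A] [Module S A]
    [AddCommGroup B] [Module S B] : Prop :=
  ∃ P Q : ModuleCat.{0} S,
    Module.Finite S P ∧ Module.Projective S P ∧
    Module.Finite S Q ∧ Module.Projective S Q ∧
    Nonempty ((A × P) ≃ₗ[S] (B × Q))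

section SingEq

variable (k : Type) [Field k]
variable (Λ Γ : Type) [Ring Λ] [Ring Γ] [Algebra k Λ] [Algebra k Γ]
variable (M : Type) [AddCommGroup M] [Module k M] [Module (Λ ⊗[k] Γᵐᵒᵖ) M]
  [IsScalarTower k (Λ ⊗[k] Γᵐᵒᵖ) M]
variable (N : Type) [AddCommGroup N] [Module k N] [Module (Γ ⊗[k] Λᵐᵒᵖ) N]
  [IsScalarTower k (Γ ⊗[k] Λᵐᵒᵖ) N]

/-- The pair of bimodules `(M, N)` defines a singular equivalence of Morita type with
level `l`:  `M`, `N` are finitely generated projective on either side, `M ⊗_Γ N` is stably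
isomorphic to `Ω_{Λᵉ}^l(Λ)` and `N ⊗_Λ M` is stably isomorphic to `Ω_{Γᵉ}^l(Γ)`. -/
noncomputable def DefinesSingEqOfLevel (l : ℕ) : Prop :=
  (letI := leftRestrict k Λ Γ M; Module.Finite Λ M ∧ Module.Projective Λ M) ∧
  (letI := rightRestrict k Λ Γ M; Module.Finite Γᵐᵒᵖ M ∧ Module.Projective Γᵐᵒᵖ M) ∧
  (letI := leftRestrict k Γ Λ N; Module.Finite Γ N ∧ Module.Projective Γ N) ∧
  (letI := rightRestrict k Γ Λ N; Module.Finite Λᵐᵒᵖ N ∧ Module.Projective Λᵐᵒᵖ N) ∧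
  (letI := regularBimodule k Λ;
    ∃ Z : ModuleCat.{0} (Λ ⊗[k] Λᵐᵒᵖ),
      IsNthSyzygyOf (Λ ⊗[k] Λᵐᵒᵖ) l Z (ModuleCat.of (Λ ⊗[k] Λᵐᵒᵖ) Λ) ∧
      StablyIso (Λ ⊗[k] Λᵐᵒᵖ) (BTensor k Λ Γ Λ M N) Z) ∧
  (letI := regularBimodule k Γ;
    ∃ Z : ModuleCat.{0} (Γ ⊗[k] Γᵐᵒᵖ),
      IsNthSyzygyOf (Γ ⊗[k] Γᵐᵒᵖ) l Z (ModuleCat.of (Γ ⊗[k] Γᵐᵒᵖ) Γ) ∧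
      StablyIso (Γ ⊗[k] Γᵐᵒᵖ) (BTensor k Γ Λ Γ N M) Z)

end SingEq

/-- A witness that `Λ` and `Γ` are singularly equivalent of Morita type with level. -/
structure SingEqMoritaLevel (k Λ Γ : Type) [Field k] [Ring Λ] [Ring Γ]
    [Algebra k Λ] [Algebra k Γ] : Type 1 where
  M : Type
  N : Type
  [acgM : AddCommGroup M] [modkM : Module k M] [modM : Module (Λ ⊗[k] Γᵐᵒᵖ) M]
  [towM : IsScalarTower k (Λ ⊗[k] Γᵐᵒᵖ) M]
  [acgN : AddCommGroup N] [modkN : Module k N] [modN : Module (Γ ⊗[k] Λᵐᵒᵖ) N]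
  [towN : IsScalarTower k (Γ ⊗[k] Λᵐᵒᵖ) N]
  l : ℕ
  defines : DefinesSingEqOfLevel k Λ Γ M N l

/-- `M` is an eventually periodic module: some syzygy `Ω^n(M)` is nonzero and periodic. -/
def IsEventuallyPeriodicModule (S : Type) [Ring S] (M : ModuleCat.{0} S) : Prop :=
  ∃ (n : ℕ) (Z : ModuleCat.{0} S), IsNthSyzygyOf S n Z M ∧ Nontrivial Z ∧
    ∃ p : ℕ, 0 < p ∧ ∃ W, IsNthSyzygyOf S p W Z ∧ Nonempty (W ≃ₗ[S] Z)

/-- `Λ` is an eventually periodic algebra: it is eventually periodic as a module over its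
enveloping algebra `Λ ⊗[k] Λᵐᵒᵖ`. -/
noncomputable def IsEventuallyPeriodicAlgebra (k Λ : Type) [Field k] [Ring Λ]
    [Algebra k Λ] : Prop :=
  letI := regularBimodule k Λ
  IsEventuallyPeriodicModule (Λ ⊗[k] Λᵐᵒᵖ) (ModuleCat.of (Λ ⊗[k] Λᵐᵒᵖ) Λ)


namespace BTensor

section API

variable {k : Type} [Field k]
variable {A B C : Type} [Ring A] [Ring B] [Ring C] [Algebra k A] [Algebra k B] [Algebra k C]
variable {X : Type} [AddCommGroup X] [Module k X] [Module (A ⊗[k] Bᵐᵒᵖ) X]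
  [IsScalarTower k (A ⊗[k] Bᵐᵒᵖ) X]
variable {Y : Type} [AddCommGroup Y] [Module k Y] [Module (B ⊗[k] Cᵐᵒᵖ) Y]
  [IsScalarTower k (B ⊗[k] Cᵐᵒᵖ) Y]

theorem outerAction_tmul_tmul (a : A) (c : Cᵐᵒᵖ) (x : X) (y : Y) :
    outerAction k A B C X Y (a ⊗ₜ c) (x ⊗ₜ y) =
      ((a ⊗ₜ[k] (1 : Bᵐᵒᵖ)) • x) ⊗ₜ[k] (((1 : B) ⊗ₜ[k] c) • y) := by
  simp [outerAction, rTensorAlgHom, lTensorAlgHom]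

variable (k A B C X Y) in
/-- The `B`-balancing relations in `X ⊗[k] Y`. -/
def relations : Set (X ⊗[k] Y) :=
  {z | ∃ (x : X) (b : B) (y : Y),
      z = ((((1 : A) ⊗ₜ[k] (op b)) • x) ⊗ₜ[k] y) - (x ⊗ₜ[k] ((b ⊗ₜ[k] (1 : Cᵐᵒᵖ)) • y))}

theorem outerAction_mem_closure (r : A ⊗[k] Cᵐᵒᵖ) {z : X ⊗[k] Y}
    (hz : z ∈ AddSubgroup.closure (relations k A B C X Y)) :
    outerAction k A B C X Y r z ∈ AddSubgroup.closure (relations k A B C X Y) := by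
  induction r with
  | zero => simp
  | add r s hr hs => rw [map_add]; exact add_mem hr hs
  | tmul a c =>
    induction hz using AddSubgroup.closure_induction with
    | zero => simp
    | add u v _ _ hu hv => rw [map_add]; exact add_mem hu hv
    | neg u _ hu => rw [map_neg]; exact neg_mem hu
    | mem u hu =>
      obtain ⟨x, b, y, rfl⟩ := hu
      apply AddSubgroup.subset_closure
      refine ⟨(a ⊗ₜ[k] (1 : Bᵐᵒᵖ)) • x, b, ((1 : B) ⊗ₜ[k] c) • y, ?_⟩
      rw [map_sub, outerAction_tmul_tmul, outerAction_tmul_tmul]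
      simp only [smul_smul, Algebra.TensorProduct.tmul_mul_tmul, one_mul, mul_one]

theorem mem_closure_of_mem_balancedSub {z : X ⊗[k] Y}
    (hz : letI := outerModule k A B C X Y; z ∈ balancedSub k A B C X Y) :
    z ∈ AddSubgroup.closure (relations k A B C X Y) := by
  letI := outerModule k A B C X Y
  refine Submodule.span_induction (p := fun z _ => z ∈ AddSubgroup.closure (relations k A B C X Y))
    (fun u hu => AddSubgroup.subset_closure hu) (zero_mem _) (fun _ _ _ _ => add_mem)
    (fun r _ _ hu => outerAction_mem_closure r hu) hz

variable (k A B C X Y) in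
/-- The quotient map onto the balanced tensor product. -/
noncomputable def mkHom : X ⊗[k] Y →+ BTensor k A B C X Y :=
  letI := outerModule k A B C X Y
  (Submodule.mkQ (balancedSub k A B C X Y)).toAddMonoidHom

theorem mkHom_surjective : Function.Surjective (mkHom k A B C X Y) := by
  letI := outerModule k A B C X Y
  exact Submodule.mkQ_surjective (balancedSub k A B C X Y)

theorem mkHom_outerAction (r : A ⊗[k] Cᵐᵒᵖ) (z : X ⊗[k] Y) :
    mkHom k A B C X Y (outerAction k A B C X Y r z) = r • mkHom k A B C X Y z := by
  letI := outerModule k A B C X Y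
  exact (Submodule.mkQ (balancedSub k A B C X Y)).map_smul r z

variable (k A B C) in
/-- The pure tensor `x ⊗ y` in the balanced tensor product. -/
noncomputable def tmul (x : X) (y : Y) : BTensor k A B C X Y := mkHom k A B C X Y (x ⊗ₜ[k] y)

theorem add_tmul (x x' : X) (y : Y) :
    tmul k A B C (x + x') y = tmul k A B C x y + tmul k A B C x' y := by
  simp [tmul, TensorProduct.add_tmul]

theorem tmul_add (x : X) (y y' : Y) :
    tmul k A B C x (y + y') = tmul k A B C x y + tmul k A B C x y' := by
  simp [tmul, TensorProduct.tmul_add]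

variable (k A B C) in
/-- Pure tensors as a biadditive map. -/
noncomputable def tmulHom : X →+ Y →+ BTensor k A B C X Y :=
  AddMonoidHom.mk' (fun x => AddMonoidHom.mk' (tmul k A B C x) (tmul_add x))
    fun x x' => by ext y; exact add_tmul x x' y

@[simp]
theorem tmulHom_apply (x : X) (y : Y) : tmulHom k A B C x y = tmul k A B C x y := rfl

theorem smul_tmul (a : A) (c : Cᵐᵒᵖ) (x : X) (y : Y) :
    (a ⊗ₜ[k] c) • tmul k A B C x y =
      tmul k A B C ((a ⊗ₜ[k] (1 : Bᵐᵒᵖ)) • x) (((1 : B) ⊗ₜ[k] c) • y) := by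
  rw [tmul, ← mkHom_outerAction, outerAction_tmul_tmul, tmul]

theorem tmul_balanced (x : X) (b : B) (y : Y) :
    tmul k A B C (((1 : A) ⊗ₜ[k] op b) • x) y =
      tmul k A B C x ((b ⊗ₜ[k] (1 : Cᵐᵒᵖ)) • y) := by
  letI := outerModule k A B C X Y
  exact (Submodule.Quotient.eq (balancedSub k A B C X Y)).2 (Submodule.subset_span ⟨x, b, y, rfl⟩)

@[elab_as_elim]
theorem induction_on {p : BTensor k A B C X Y → Prop} (z : BTensor k A B C X Y)
    (zero : p 0) (tmul : ∀ x y, p (tmul k A B C x y)) (add : ∀ u v, p u → p v → p (u + v)) :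
    p z := by
  obtain ⟨w, rfl⟩ := mkHom_surjective z
  induction w with
  | zero => simpa using zero
  | tmul x y => exact tmul x y
  | add u v hu hv => rw [map_add]; exact add _ _ hu hv

variable {Z : Type} [AddCommGroup Z]

theorem map_smul_eq_of_balanced (f : X →+ Y →+ Z)
    (hf : ∀ x (b : B) y,
      f (((1 : A) ⊗ₜ[k] op b) • x) y = f x ((b ⊗ₜ[k] (1 : Cᵐᵒᵖ)) • y))
    (c : k) (x : X) (y : Y) : f (c • x) y = f x (c • y) := by
  have hx : ((1 : A) ⊗ₜ[k] op (algebraMap k B c)) • x = c • x := by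
    rw [← MulOpposite.algebraMap_apply, Algebra.algebraMap_eq_smul_one, TensorProduct.tmul_smul,
      ← Algebra.TensorProduct.one_def, smul_assoc, one_smul]
  have hy : (algebraMap k B c ⊗ₜ[k] (1 : Cᵐᵒᵖ)) • y = c • y := by
    rw [Algebra.algebraMap_eq_smul_one, ← TensorProduct.smul_tmul',
      ← Algebra.TensorProduct.one_def, smul_assoc, one_smul]
  rw [← hx, hf, hy]

/-- A balanced biadditive map factors through the balanced tensor product. -/
noncomputable def lift (f : X →+ Y →+ Z)
    (hf : ∀ x (b : B) y,
      f (((1 : A) ⊗ₜ[k] op b) • x) y = f x ((b ⊗ₜ[k] (1 : Cᵐᵒᵖ)) • y)) :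
    BTensor k A B C X Y →+ Z :=
  letI := outerModule k A B C X Y
  QuotientAddGroup.lift (balancedSub k A B C X Y).toAddSubgroup
    (TensorProduct.liftAddHom f (map_smul_eq_of_balanced f hf)) fun z hz => by
      refine (AddSubgroup.closure_le (AddMonoidHom.ker _)).2 ?_ (mem_closure_of_mem_balancedSub hz)
      rintro _ ⟨x, b, y, rfl⟩
      simp [AddMonoidHom.mem_ker, hf]

@[simp]
theorem lift_tmul (f : X →+ Y →+ Z)
    (hf : ∀ x (b : B) y,
      f (((1 : A) ⊗ₜ[k] op b) • x) y = f x ((b ⊗ₜ[k] (1 : Cᵐᵒᵖ)) • y)) (x : X) (y : Y) :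
    lift f hf (tmul k A B C x y) = f x y := rfl

/-- A balanced biadditive map compatible with the outer actions induces a bimodule map. -/
noncomputable def liftLinear [Module (A ⊗[k] Cᵐᵒᵖ) Z] (f : X →+ Y →+ Z)
    (hf : ∀ x (b : B) y,
      f (((1 : A) ⊗ₜ[k] op b) • x) y = f x ((b ⊗ₜ[k] (1 : Cᵐᵒᵖ)) • y))
    (hs : ∀ (a : A) (c : Cᵐᵒᵖ) x y,
      f ((a ⊗ₜ[k] (1 : Bᵐᵒᵖ)) • x) (((1 : B) ⊗ₜ[k] c) • y) = (a ⊗ₜ[k] c) • f x y) :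
    BTensor k A B C X Y →ₗ[A ⊗[k] Cᵐᵒᵖ] Z :=
  { lift f hf with
    map_smul' := fun r z => by
      change lift f hf (r • z) = r • lift f hf z
      induction r with
      | zero =>
        exact (congrArg _ (zero_smul (A ⊗[k] Cᵐᵒᵖ) z)).trans
          ((map_zero _).trans (zero_smul (A ⊗[k] Cᵐᵒᵖ) (lift f hf z)).symm)
      | add r s hr hs => rw [add_smul, map_add, hr, hs, add_smul]
      | tmul a c =>
        induction z using induction_on with
        | zero => rw [smul_zero, map_zero, smul_zero]
        | add u v hu hv => rw [smul_add, map_add, hu, hv, map_add, smul_add]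
        | tmul x y => rw [smul_tmul, lift_tmul, lift_tmul, hs] }

@[simp]
theorem liftLinear_tmul [Module (A ⊗[k] Cᵐᵒᵖ) Z] (f : X →+ Y →+ Z)
    (hf : ∀ x (b : B) y,
      f (((1 : A) ⊗ₜ[k] op b) • x) y = f x ((b ⊗ₜ[k] (1 : Cᵐᵒᵖ)) • y))
    (hs : ∀ (a : A) (c : Cᵐᵒᵖ) x y,
      f ((a ⊗ₜ[k] (1 : Bᵐᵒᵖ)) • x) (((1 : B) ⊗ₜ[k] c) • y) = (a ⊗ₜ[k] c) • f x y)
    (x : X) (y : Y) : liftLinear f hf hs (tmul k A B C x y) = f x y := rfl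

variable {Y' : Type} [AddCommGroup Y'] [Module k Y'] [Module (B ⊗[k] Cᵐᵒᵖ) Y']
  [IsScalarTower k (B ⊗[k] Cᵐᵒᵖ) Y']

variable (k A B C X) in
/-- Functoriality of the balanced tensor product in the second variable. -/
noncomputable def map (g : Y →ₗ[B ⊗[k] Cᵐᵒᵖ] Y') :
    BTensor k A B C X Y →ₗ[A ⊗[k] Cᵐᵒᵖ] BTensor k A B C X Y' :=
  liftLinear ((tmulHom k A B C).compl₂ g.toAddMonoidHom)
    (fun x b y => by simp [tmul_balanced]) (fun a c x y => by simp [smul_tmul])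

@[simp]
theorem map_tmul (g : Y →ₗ[B ⊗[k] Cᵐᵒᵖ] Y') (x : X) (y : Y) :
    map k A B C X g (tmul k A B C x y) = tmul k A B C x (g y) := rfl

/-- A dual basis for a bimodule that is projective as a left module. -/
theorem exists_leftDualBasis (h : letI := leftRestrict k A B X; Module.Projective A X) :
    ∃ s : X →+ (X →₀ A), (∀ (a : A) x, s ((a ⊗ₜ[k] (1 : Bᵐᵒᵖ)) • x) = a • s x) ∧
      ∀ x, ((s x).sum fun x' a => (a ⊗ₜ[k] (1 : Bᵐᵒᵖ)) • x') = x := by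
  let := leftRestrict k A B X
  obtain ⟨s, hs⟩ := h.out
  exact ⟨s.toAddMonoidHom, s.map_smul, hs⟩

/-- A dual basis for a bimodule that is projective as a right module. -/
theorem exists_rightDualBasis (h : letI := rightRestrict k A B X; Module.Projective Bᵐᵒᵖ X) :
    ∃ s : X →+ (X →₀ Bᵐᵒᵖ), (∀ (b : Bᵐᵒᵖ) x, s (((1 : A) ⊗ₜ[k] b) • x) = b • s x) ∧
      ∀ x, ((s x).sum fun x' b => ((1 : A) ⊗ₜ[k] b) • x') = x := by
  let := rightRestrict k A B X
  obtain ⟨s, hs⟩ := h.out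
  exact ⟨s.toAddMonoidHom, s.map_smul, hs⟩

section RightProjective

variable (s : X →+ (X →₀ Bᵐᵒᵖ)) (hsb : ∀ (b : Bᵐᵒᵖ) x, s (((1 : A) ⊗ₜ[k] b) • x) = b • s x)

variable (k C Y) in
/-- The coordinates of `x ⊗ y` with respect to a right dual basis of `X`. -/
noncomputable def rightCoordHom : X →+ Y →+ (X →₀ Y) :=
  AddMonoidHom.mk'
    (fun x => AddMonoidHom.mk'
      (fun y => (s x).mapRange (fun r => (unop r ⊗ₜ[k] (1 : Cᵐᵒᵖ)) • y)
        (by rw [unop_zero, TensorProduct.zero_tmul]; exact zero_smul (B ⊗[k] Cᵐᵒᵖ) y))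
      (fun y y' => by ext; simp))
    (fun x x' => by ext; simp [TensorProduct.add_tmul, add_smul])

theorem rightCoordHom_apply (x : X) (y : Y) (x' : X) :
    rightCoordHom k C Y s x y x' = (unop (s x x') ⊗ₜ[k] (1 : Cᵐᵒᵖ)) • y := rfl

variable (k C Y) in
/-- The embedding of `X ⊗_B Y` into a direct sum of copies of `Y` given by a right dual basis. -/
noncomputable def rightCoord : BTensor k A B C X Y →+ (X →₀ Y) :=
  lift (rightCoordHom k C Y s) fun x b y => by
    ext x'
    simp [rightCoordHom_apply, hsb, smul_smul]

variable (k A B C X Y) in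
/-- The map from a direct sum of copies of `Y` to `X ⊗_B Y` induced by the elements of `X`. -/
noncomputable def ofFinsupp : (X →₀ Y) →+ BTensor k A B C X Y :=
  Finsupp.liftAddHom fun x => tmulHom k A B C x

theorem ofFinsupp_rightCoord (hs : ∀ x, ((s x).sum fun x' b => ((1 : A) ⊗ₜ[k] b) • x') = x)
    (z : BTensor k A B C X Y) :
    ofFinsupp k A B C X Y (rightCoord k C Y s hsb z) = z := by
  induction z using induction_on with
  | zero => simp
  | add u v hu hv => rw [map_add, map_add, hu, hv]
  | tmul x y =>
    have h : ofFinsupp k A B C X Y (rightCoordHom k C Y s x y) =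
        (s x).sum fun x' b => (tmulHom k A B C).flip y (((1 : A) ⊗ₜ[k] b) • x') := by
      rw [ofFinsupp, Finsupp.liftAddHom_apply]
      refine (Finsupp.sum_mapRange_index
        (hf := by rw [unop_zero, TensorProduct.zero_tmul]; exact zero_smul (B ⊗[k] Cᵐᵒᵖ) y)
        (fun _ => map_zero _)).trans ?_
      refine Finsupp.sum_congr fun x' _ => ?_
      exact (tmul_balanced x' (unop (s x x')) y).symm
    rw [rightCoord, lift_tmul, h, ← map_finsuppSum, hs]
    rfl

theorem rightCoord_map (g : Y →ₗ[B ⊗[k] Cᵐᵒᵖ] Y') (z : BTensor k A B C X Y) :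
    rightCoord k C Y' s hsb (map k A B C X g z) =
      Finsupp.mapRange.addMonoidHom g.toAddMonoidHom (rightCoord k C Y s hsb z) := by
  induction z using induction_on with
  | zero => simp
  | add u v hu hv => simp only [map_add, hu, hv]
  | tmul x y =>
    ext x'
    simp [rightCoord, rightCoordHom_apply]

theorem map_ofFinsupp (g : Y →ₗ[B ⊗[k] Cᵐᵒᵖ] Y') (w : X →₀ Y) :
    map k A B C X g (ofFinsupp k A B C X Y w) =
      ofFinsupp k A B C X Y' (Finsupp.mapRange.addMonoidHom g.toAddMonoidHom w) := by
  induction w using Finsupp.induction_linear with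
  | zero => simp
  | add u v hu hv => simp only [map_add, hu, hv]
  | single x y =>
    rw [ofFinsupp, ofFinsupp, Finsupp.liftAddHom_apply_single, Finsupp.mapRange.addMonoidHom_apply,
      Finsupp.mapRange_single, Finsupp.liftAddHom_apply_single]
    rfl

end RightProjective

theorem map_injective (h : letI := rightRestrict k A B X; Module.Projective Bᵐᵒᵖ X)
    {g : Y →ₗ[B ⊗[k] Cᵐᵒᵖ] Y'} (hg : Function.Injective g) :
    Function.Injective (map k A B C X g) := by
  obtain ⟨s, hsb, hs⟩ := exists_rightDualBasis h
  refine (injective_iff_map_eq_zero _).2 fun z hz => ?_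
  have h0 := rightCoord_map s hsb g z
  rw [hz, map_zero] at h0
  rw [← ofFinsupp_rightCoord s hsb hs z]
  have h1 : rightCoord k C Y s hsb z = 0 := Finsupp.mapRange_injective g (map_zero g) hg
    (h0.symm.trans (map_zero (Finsupp.mapRange.addMonoidHom g.toAddMonoidHom)).symm)
  rw [h1, map_zero]

theorem map_surjective {g : Y →ₗ[B ⊗[k] Cᵐᵒᵖ] Y'} (hg : Function.Surjective g) :
    Function.Surjective (map k A B C X g) := by
  intro z
  induction z using induction_on with
  | zero => exact ⟨0, map_zero _⟩
  | add u v hu hv =>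
    obtain ⟨u, rfl⟩ := hu
    obtain ⟨v, rfl⟩ := hv
    exact ⟨u + v, map_add _ _ _⟩
  | tmul x y =>
    obtain ⟨y, rfl⟩ := hg y
    exact ⟨tmul k A B C x y, rfl⟩

theorem map_exact {Y'' : Type} [AddCommGroup Y''] [Module k Y''] [Module (B ⊗[k] Cᵐᵒᵖ) Y'']
    [IsScalarTower k (B ⊗[k] Cᵐᵒᵖ) Y'']
    (h : letI := rightRestrict k A B X; Module.Projective Bᵐᵒᵖ X)
    {f : Y →ₗ[B ⊗[k] Cᵐᵒᵖ] Y'} {g : Y' →ₗ[B ⊗[k] Cᵐᵒᵖ] Y''} (hfg : Function.Exact f g) :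
    Function.Exact (map k A B C X f) (map k A B C X g) := by
  obtain ⟨s, hsb, hs⟩ := exists_rightDualBasis h
  intro z
  constructor
  · intro hz
    have h0 := rightCoord_map s hsb g z
    rw [hz, map_zero] at h0
    have h1 : ∀ x, ∃ y, f y = rightCoord k C Y' s hsb z x := fun x =>
      (hfg _).1 (DFunLike.congr_fun h0 x).symm
    obtain ⟨w, hw⟩ : ∃ w : X →₀ Y, Finsupp.mapRange.addMonoidHom f.toAddMonoidHom w =
        rightCoord k C Y' s hsb z := by
      choose e he using h1
      classical
      refine ⟨Finsupp.onFinset (rightCoord k C Y' s hsb z).support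
        (fun x => if rightCoord k C Y' s hsb z x = 0 then 0 else e x) ?_, ?_⟩
      · intro x hx
        by_contra h2
        simp_all
      · ext x
        by_cases h2 : rightCoord k C Y' s hsb z x = 0 <;> simp [h2, he]
    refine ⟨ofFinsupp k A B C X Y w, ?_⟩
    rw [map_ofFinsupp, hw, ofFinsupp_rightCoord s hsb hs]
  · rintro ⟨z, rfl⟩
    induction z using induction_on with
    | zero => simp
    | add u v hu hv => simp only [map_add, hu, hv, add_zero]
    | tmul x y =>
      rw [map_tmul, map_tmul, hfg.apply_apply_eq_zero]
      exact map_zero (tmulHom k A B C x)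

section LeftProjective

variable (s : X →+ (X →₀ A)) (hsa : ∀ (a : A) x, s ((a ⊗ₜ[k] (1 : Bᵐᵒᵖ)) • x) = a • s x)

/-- The coordinates of `x ⊗ r` in copies of `A ⊗ Cᵐᵒᵖ`, for `r` in the free bimodule of rank one,
with respect to a left dual basis of `X`. -/
noncomputable def leftCoordAux (x : X) : B ⊗[k] Cᵐᵒᵖ →+ (X →₀ A ⊗[k] Cᵐᵒᵖ) :=
  TensorProduct.liftAddHom
    (AddMonoidHom.mk'
      (fun b => AddMonoidHom.mk'
        (fun c => (s (((1 : A) ⊗ₜ[k] op b) • x)).mapRange (fun a => a ⊗ₜ[k] c)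
          (TensorProduct.zero_tmul _ _))
        (fun c c' => by ext; simp [TensorProduct.tmul_add]))
      (fun b b' => by
        ext c x'
        simp [TensorProduct.tmul_add, add_smul, TensorProduct.add_tmul]))
    (fun r b c => by
      ext x'
      have h : ((1 : A) ⊗ₜ[k] op (r • b)) • x =
          ((r • (1 : A)) ⊗ₜ[k] (1 : Bᵐᵒᵖ)) • ((1 : A) ⊗ₜ[k] op b) • x := by
        rw [smul_smul, Algebra.TensorProduct.tmul_mul_tmul, one_mul, mul_one, op_smul,
          TensorProduct.smul_tmul]
      change s (((1 : A) ⊗ₜ[k] op (r • b)) • x) x' ⊗ₜ[k] c =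
        s (((1 : A) ⊗ₜ[k] op b) • x) x' ⊗ₜ[k] (r • c)
      rw [h, hsa, Finsupp.smul_apply, smul_eq_mul, smul_mul_assoc, one_mul,
        TensorProduct.smul_tmul])

theorem leftCoordAux_tmul_apply (x : X) (b : B) (c : Cᵐᵒᵖ) (x' : X) :
    leftCoordAux s hsa x (b ⊗ₜ[k] c) x' = s (((1 : A) ⊗ₜ[k] op b) • x) x' ⊗ₜ[k] c := rfl

theorem leftCoordAux_add (x x' : X) (r : B ⊗[k] Cᵐᵒᵖ) :
    leftCoordAux s hsa (x + x') r = leftCoordAux s hsa x r + leftCoordAux s hsa x' r := by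
  induction r with
  | zero => simp
  | add u v hu hv => simp only [map_add, hu, hv]; abel
  | tmul b c =>
    ext
    simp [leftCoordAux_tmul_apply, TensorProduct.add_tmul]

theorem leftCoordAux_balanced (x : X) (b : B) (r : B ⊗[k] Cᵐᵒᵖ) :
    leftCoordAux s hsa (((1 : A) ⊗ₜ[k] op b) • x) r =
      leftCoordAux s hsa x ((b ⊗ₜ[k] (1 : Cᵐᵒᵖ)) * r) := by
  induction r with
  | zero => simp
  | add u v hu hv => simp only [map_add, hu, hv, mul_add]
  | tmul b' c =>
    ext
    simp [leftCoordAux_tmul_apply, smul_smul]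

theorem leftCoordAux_smul (x : X) (a : A) (c : Cᵐᵒᵖ) (r : B ⊗[k] Cᵐᵒᵖ) :
    leftCoordAux s hsa ((a ⊗ₜ[k] (1 : Bᵐᵒᵖ)) • x) (((1 : B) ⊗ₜ[k] c) * r) =
      (a ⊗ₜ[k] c) • leftCoordAux s hsa x r := by
  induction r with
  | zero => simp
  | add u v hu hv => simp only [map_add, hu, hv, mul_add, smul_add]
  | tmul b c' =>
    ext x'
    have h : ((1 : A) ⊗ₜ[k] op b) • (a ⊗ₜ[k] (1 : Bᵐᵒᵖ)) • x =
        (a ⊗ₜ[k] (1 : Bᵐᵒᵖ)) • ((1 : A) ⊗ₜ[k] op b) • x := by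
      simp [smul_smul]
    simp [leftCoordAux_tmul_apply, h, hsa]

theorem linearCombination_leftCoordAux
    (hs : ∀ x, ((s x).sum fun x' a => (a ⊗ₜ[k] (1 : Bᵐᵒᵖ)) • x') = x)
    (x : X) (r : B ⊗[k] Cᵐᵒᵖ) (y : Y) :
    Finsupp.linearCombination (A ⊗[k] Cᵐᵒᵖ) (fun x' => tmul k A B C x' y)
      (leftCoordAux s hsa x r) = tmul k A B C x (r • y) := by
  induction r with
  | zero =>
    rw [map_zero, map_zero]
    exact ((congrArg _ (zero_smul (B ⊗[k] Cᵐᵒᵖ) y)).trans (map_zero (tmulHom k A B C x))).symm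
  | add u v hu hv => rw [map_add, map_add, hu, hv, add_smul, tmul_add]
  | tmul b c =>
    have h : Finsupp.linearCombination (A ⊗[k] Cᵐᵒᵖ) (fun x' => tmul k A B C x' y)
        (leftCoordAux s hsa x (b ⊗ₜ[k] c)) =
        (s (((1 : A) ⊗ₜ[k] op b) • x)).sum fun x' a =>
          (tmulHom k A B C).flip (((1 : B) ⊗ₜ[k] c) • y) ((a ⊗ₜ[k] (1 : Bᵐᵒᵖ)) • x') := by
      rw [Finsupp.linearCombination_apply]
      refine (Finsupp.sum_mapRange_index (f := fun a => a ⊗ₜ[k] c)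
        (hf := TensorProduct.zero_tmul _ _) (h := fun x' t => t • tmul k A B C x' y)
        (fun x' : X => zero_smul (A ⊗[k] Cᵐᵒᵖ) (tmul k A B C x' y))).trans ?_
      exact Finsupp.sum_congr fun x' _ => smul_tmul _ c x' y
    rw [h, ← map_finsuppSum, hs]
    simp [tmul_balanced, smul_smul]

end LeftProjective

/-- A criterion for projectivity of `X ⊗_B Y` in terms of copies of a projective module `V` indexed
by a dual basis of `Y`. -/
theorem projective_of_coord {V : Type} [AddCommGroup V] [Module (A ⊗[k] Cᵐᵒᵖ) V]
    [Module.Projective (A ⊗[k] Cᵐᵒᵖ) V] [hY : Module.Projective (B ⊗[k] Cᵐᵒᵖ) Y]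
    (θ : X → B ⊗[k] Cᵐᵒᵖ →+ V) (hadd : ∀ x x' r, θ (x + x') r = θ x r + θ x' r)
    (hbal : ∀ (x : X) (b : B) (r : B ⊗[k] Cᵐᵒᵖ),
      θ (((1 : A) ⊗ₜ[k] op b) • x) r = θ x ((b ⊗ₜ[k] (1 : Cᵐᵒᵖ)) * r))
    (hsmul : ∀ (x : X) (a : A) (c : Cᵐᵒᵖ) (r : B ⊗[k] Cᵐᵒᵖ),
      θ ((a ⊗ₜ[k] (1 : Bᵐᵒᵖ)) • x) (((1 : B) ⊗ₜ[k] c) * r) = (a ⊗ₜ[k] c) • θ x r)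
    (e : Y → V →ₗ[A ⊗[k] Cᵐᵒᵖ] BTensor k A B C X Y)
    (he : ∀ x r y, e y (θ x r) = tmul k A B C x (r • y)) :
    Module.Projective (A ⊗[k] Cᵐᵒᵖ) (BTensor k A B C X Y) := by
  obtain ⟨t, ht⟩ := hY.out
  let F : X →+ Y →+ (Y →₀ V) :=
    AddMonoidHom.mk'
      (fun x => (Finsupp.mapRange.addMonoidHom (θ x)).comp t.toAddMonoidHom)
      (fun x x' => by
        ext1 y
        ext1 y'
        exact hadd x x' (t y y'))
  have hF : ∀ x y y', F x y y' = θ x (t y y') := fun _ _ _ => rfl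
  let i : BTensor k A B C X Y →ₗ[A ⊗[k] Cᵐᵒᵖ] (Y →₀ V) :=
    liftLinear F
      (fun x b y => by ext1 y'; rw [hF, hF, hbal, map_smul]; rfl)
      (fun a c x y => by
        ext1 y'
        rw [Finsupp.smul_apply, hF, hF, map_smul, ← hsmul]
        rfl)
  let p : (Y →₀ V) →ₗ[A ⊗[k] Cᵐᵒᵖ] BTensor k A B C X Y := Finsupp.lsum ℕ e
  classical
  have : Module.Projective (A ⊗[k] Cᵐᵒᵖ) (Y →₀ V) :=
    Module.Projective.of_equiv (finsuppLEquivDirectSum (A ⊗[k] Cᵐᵒᵖ) V Y).symm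
  refine Module.Projective.of_split i p (LinearMap.ext fun z => ?_)
  change p (i z) = z
  induction z using induction_on with
  | zero => simp
  | add u v hu hv => rw [map_add, map_add, hu, hv]
  | tmul x y =>
    have h1 : p (F x y) = (t y).sum fun y' r => tmulHom k A B C x (r • y') := by
      rw [Finsupp.lsum_apply]
      refine (Finsupp.sum_mapRange_index (hf := map_zero _) (fun _ => map_zero _)).trans ?_
      exact Finsupp.sum_congr fun y' _ => he x (t y y') y'
    rw [liftLinear_tmul, h1, ← map_finsuppSum]
    exact congrArg (tmul k A B C x) (ht y)

theorem projective (h : letI := leftRestrict k A B X; Module.Projective A X)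
    [Module.Projective (B ⊗[k] Cᵐᵒᵖ) Y] :
    Module.Projective (A ⊗[k] Cᵐᵒᵖ) (BTensor k A B C X Y) := by
  obtain ⟨s, hsa, hs⟩ := exists_leftDualBasis h
  exact projective_of_coord (V := X →₀ A ⊗[k] Cᵐᵒᵖ) (leftCoordAux s hsa) (leftCoordAux_add s hsa)
    (leftCoordAux_balanced s hsa) (leftCoordAux_smul s hsa)
    (fun y => Finsupp.linearCombination (A ⊗[k] Cᵐᵒᵖ) fun x => tmul k A B C x y)
    fun x r y => linearCombination_leftCoordAux s hsa hs x r y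

theorem finite [FiniteDimensional k A] [FiniteDimensional k B] [FiniteDimensional k C]
    [Module.Finite (A ⊗[k] Bᵐᵒᵖ) X] [Module.Finite (B ⊗[k] Cᵐᵒᵖ) Y] :
    Module.Finite (A ⊗[k] Cᵐᵒᵖ) (BTensor k A B C X Y) := by
  have : Module.Finite k Bᵐᵒᵖ := Module.Finite.equiv (MulOpposite.opLinearEquiv k)
  have : Module.Finite k Cᵐᵒᵖ := Module.Finite.equiv (MulOpposite.opLinearEquiv k)
  have : Module.Finite k X := Module.Finite.trans (A ⊗[k] Bᵐᵒᵖ) X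
  have : Module.Finite k Y := Module.Finite.trans (B ⊗[k] Cᵐᵒᵖ) Y
  let q : X ⊗[k] Y →ₗ[k] BTensor k A B C X Y :=
    { mkHom k A B C X Y with
      map_smul' := fun c z => by
        change mkHom k A B C X Y (c • z) = algebraMap k (A ⊗[k] Cᵐᵒᵖ) c • mkHom k A B C X Y z
        rw [← mkHom_outerAction, AlgHom.commutes, Module.algebraMap_end_apply] }
  have : Module.Finite k (BTensor k A B C X Y) := Module.Finite.of_surjective q mkHom_surjective
  exact Module.Finite.of_restrictScalars_finite k (A ⊗[k] Cᵐᵒᵖ) _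

end API

end BTensor

/-- Schanuel's lemma. -/
theorem nonempty_ker_prod_equiv_of_projective {S P Q N : Type*} [Ring S]
    [AddCommGroup P] [AddCommGroup Q] [AddCommGroup N] [Module S P] [Module S Q] [Module S N]
    [Module.Projective S P] [Module.Projective S Q] {p : P →ₗ[S] N} {q : Q →ₗ[S] N}
    (hp : Function.Surjective p) (hq : Function.Surjective q) :
    Nonempty ((LinearMap.ker p × Q) ≃ₗ[S] (LinearMap.ker q × P)) := by
  obtain ⟨h, hh⟩ := Module.projective_lifting_property q p hq
  obtain ⟨g, hg⟩ := Module.projective_lifting_property p q hp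
  have hh' (x : P) : q (h x) = p x := LinearMap.congr_fun hh x
  have hg' (x : Q) : p (g x) = q x := LinearMap.congr_fun hg x
  have hu : ∀ z : LinearMap.ker p × Q,
      (LinearMap.snd S (LinearMap.ker p) Q - h ∘ₗ ((LinearMap.ker p).subtype.coprod g)) z ∈
        LinearMap.ker q := by
    rintro ⟨⟨a, ha⟩, x⟩
    simp [hh', hg', LinearMap.mem_ker.1 ha]
  have hv : ∀ z : LinearMap.ker q × P,
      (LinearMap.snd S (LinearMap.ker q) P - g ∘ₗ ((LinearMap.ker q).subtype.coprod h)) z ∈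
        LinearMap.ker p := by
    rintro ⟨⟨a, ha⟩, x⟩
    simp [hh', hg', LinearMap.mem_ker.1 ha]
  refine ⟨LinearEquiv.ofLinearMap
    ((LinearMap.codRestrict _ _ hu).prod ((LinearMap.ker p).subtype.coprod g))
    ((LinearMap.codRestrict _ _ hv).prod ((LinearMap.ker q).subtype.coprod h)) ?_ ?_⟩
  · ext x <;> simp
  · ext x <;> simp

/-- if `M` is projective as a left `Λ`-module and as a right `Γ`-module,
then `Ω_{Λᵉ}(M ⊗_Γ N)` is stably isomorphic to `M ⊗_Γ Ω_{Γ⊗Λᵒᵖ}(N)`. -/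
theorem statement_12 (k Λ Γ : Type) [Field k] [Ring Λ] [Ring Γ]
    [Algebra k Λ] [Algebra k Γ] [FiniteDimensional k Λ] [FiniteDimensional k Γ]
    (M : Type) [AddCommGroup M] [Module k M] [Module (Λ ⊗[k] Γᵐᵒᵖ) M]
    [IsScalarTower k (Λ ⊗[k] Γᵐᵒᵖ) M]
    (hMfg : Module.Finite (Λ ⊗[k] Γᵐᵒᵖ) M)
    (hMprojL : letI := leftRestrict k Λ Γ M; Module.Projective Λ M)
    (hMprojR : letI := rightRestrict k Λ Γ M; Module.Projective Γᵐᵒᵖ M)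
    (N : Type) [AddCommGroup N] [Module k N] [Module (Γ ⊗[k] Λᵐᵒᵖ) N]
    [IsScalarTower k (Γ ⊗[k] Λᵐᵒᵖ) N]
    (hNfg : Module.Finite (Γ ⊗[k] Λᵐᵒᵖ) N)
    (SN : ModuleCat.{0} (Γ ⊗[k] Λᵐᵒᵖ))
    (hSN : IsSyzygyOf (Γ ⊗[k] Λᵐᵒᵖ) SN (ModuleCat.of (Γ ⊗[k] Λᵐᵒᵖ) N))
    (W : ModuleCat.{0} (Λ ⊗[k] Λᵐᵒᵖ))
    (hW : IsSyzygyOf (Λ ⊗[k] Λᵐᵒᵖ) W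
      (ModuleCat.of (Λ ⊗[k] Λᵐᵒᵖ) (BTensor k Λ Γ Λ M N))) :
    letI : Module k SN := modK k (Γ ⊗[k] Λᵐᵒᵖ) SN
    letI : IsScalarTower k (Γ ⊗[k] Λᵐᵒᵖ) SN := towerK k (Γ ⊗[k] Λᵐᵒᵖ) SN
    StablyIso (Λ ⊗[k] Λᵐᵒᵖ) W (BTensor k Λ Γ Λ M SN) := by
  let : Module k SN := modK k (Γ ⊗[k] Λᵐᵒᵖ) SN
  have : IsScalarTower k (Γ ⊗[k] Λᵐᵒᵖ) SN := towerK k (Γ ⊗[k] Λᵐᵒᵖ) SN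
  obtain ⟨P, p, ⟨hPfin, hPproj, hp, -⟩, ⟨e⟩⟩ := hSN
  obtain ⟨Q, q, ⟨hQfin, hQproj, hq, -⟩, ⟨e'⟩⟩ := hW
  let : Module k P := modK k (Γ ⊗[k] Λᵐᵒᵖ) P
  have : IsScalarTower k (Γ ⊗[k] Λᵐᵒᵖ) P := towerK k (Γ ⊗[k] Λᵐᵒᵖ) P
  let p' : P →ₗ[Γ ⊗[k] Λᵐᵒᵖ] N := p
  let i : SN →ₗ[Γ ⊗[k] Λᵐᵒᵖ] P := (LinearMap.ker p').subtype ∘ₗ e.toLinearMap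
  have hi : Function.Injective i := Subtype.val_injective.comp e.injective
  have hip : Function.Exact i p' := fun y =>
    ⟨fun hy => ⟨e.symm ⟨y, hy⟩, congrArg Subtype.val (e.apply_symm_apply ⟨y, hy⟩)⟩,
      by rintro ⟨z, rfl⟩; exact (e z).2⟩
  have hproj : Module.Projective (Λ ⊗[k] Λᵐᵒᵖ) (BTensor k Λ Γ Λ M P) :=
    BTensor.projective hMprojL
  have hfin : Module.Finite (Λ ⊗[k] Λᵐᵒᵖ) (BTensor k Λ Γ Λ M P) := BTensor.finite
  obtain ⟨E⟩ := nonempty_ker_prod_equiv_of_projective hq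
    (BTensor.map_surjective (k := k) (A := Λ) (X := M) (g := p') hp)
  let j : BTensor k Λ Γ Λ M SN ≃ₗ[Λ ⊗[k] Λᵐᵒᵖ] LinearMap.ker (BTensor.map k Λ Γ Λ M p') :=
    (LinearEquiv.ofInjective _ (BTensor.map_injective hMprojR hi)).trans
      (LinearEquiv.ofEq _ _ (BTensor.map_exact hMprojR hip).linearMap_ker_eq.symm)
  exact ⟨ModuleCat.of _ (BTensor k Λ Γ Λ M P), Q, hfin, hproj, hQfin, hQproj,
    ⟨(e'.prodCongr (.refl _ _)).trans (E.trans (j.symm.prodCongr (.refl _ _)))⟩⟩
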